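/- Let ξ = √2 − 1 and let 𝒱 ⊂ ℝ³ be the set of the N = 24 vertices of the truncated cube: all vectors obtained as coordinate permutations of (±ξ,±1,±1). Then max_{v ∈ 𝒱^N̲} |⟨v⟩|₂² = 47040 + 23168√2. Consequently, for the unit-normalized ensemble 𝒱/√(5−2√2) one has g = (47040 + 23168√2)/(5 − 2√2), and its minimum guesswork is (1/2)·(25 − √g/24) ≈ 8.5062. -/

import Mathlib

open Pointwise

noncomputable section

abbrev E3 := EuclideanSpace ℝ (Fin 3)

/-- The vector `(a, b, c)` in ℝ³ with the Euclidean norm. -/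
def vec3 (a b c : ℝ) : E3 := (WithLp.equiv 2 (Fin 3 → ℝ)).symm ![a, b, c]

/-- `⟨v⟩ := Σ_{i=1}^N (2i − N + 1)·vᵢ` (here `i : Fin N` is 0-based, so the
coefficient reads `2(i+1) − N + 1 = 2i + 3 − N`). -/
def tupleAvg (N : ℕ) (v : Fin N → E3) : E3 :=
  ∑ i : Fin N, (2 * (i : ℝ) + 3 - N) • v i

/-- The set of values `|⟨v⟩|₂²` as `v` ranges over the `N`-tuples on `𝒱` without
repetition (i.e. bijective enumerations of `𝒱`). -/
def normSqSet (𝒱 : Set E3) (N : ℕ) : Set ℝ :=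
  {x | ∃ v : Fin N → E3, Function.Injective v ∧ Set.range v = 𝒱 ∧ x = ‖tupleAvg N v‖ ^ 2}

/-- The vertices of the truncated cube: all coordinate permutations of `(±ξ, ±1, ±1)`
with `ξ = √2 − 1`. -/
def truncatedCube : Set E3 :=
  {v | ∃ σ : Equiv.Perm (Fin 3), ∃ s : Fin 3 → ℝ, (∀ i, s i = 1 ∨ s i = -1) ∧
       v = (WithLp.equiv 2 (Fin 3 → ℝ)).symm
             (fun i => s i * ![Real.sqrt 2 - 1, 1, 1] (σ i))}

/-- The twelve pairs `(t, r)` for which `± (ξ * t + r)` are the inner products of `(x, y, z)` with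
the vertices of the truncated cube. The order and the signs are such that `ξ * t + r` is
nonnegative and increasing when `(x, y, z)` is close to the optimal direction. -/
def cubeForm {R : Type*} [AddCommGroup R] (x y z : R) : Fin 12 → R × R :=
  ![(-x, y - z), (-x, y + z), (-z, x - y), (z, x - y), (-y, x - z), (-y, x + z),
    (x, y - z), (x, y + z), (y, x - z), (y, x + z), (-z, x + y), (z, x + y)]

/-- The value `ξ * t + r` of a form at a real point. -/
def formVal (x y z : ℝ) (i : Fin 12) : ℝ :=
  (√2 - 1) * (cubeForm x y z i).1 + (cubeForm x y z i).2

/-- `2 ∑ᵢ ∑ⱼ max |cᵢ| |cⱼ|`. -/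
def maxSum {n : ℕ} (c : Fin n → ℝ) : ℝ := 2 * ∑ i, ∑ j, max |c i| |c j|

/-- The support function of the zonotope generated by the differences of vertices. -/
def cubeSupport (x y z : ℝ) : ℝ := maxSum (formVal x y z)

section Rearrangement

lemma sum_coeff_le_sum_abs_sub (n : ℕ) (b : Fin n → ℝ) :
    ∑ i : Fin n, (2 * (i : ℝ) + 1 - n) * b i ≤ 1 / 2 * ∑ i, ∑ j, |b i - b j| := by
  induction n with
  | zero => simp
  | succ n ih =>
    have key := ih fun i => b i.castSucc
    have hlast : ∑ i : Fin n, (b (Fin.last n) - b i.castSucc)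
        ≤ ∑ i : Fin n, |b (Fin.last n) - b i.castSucc| :=
      Finset.sum_le_sum fun i _ => le_abs_self _
    have hcomm : ∑ i : Fin n, |b i.castSucc - b (Fin.last n)|
        = ∑ i : Fin n, |b (Fin.last n) - b i.castSucc| :=
      Finset.sum_congr rfl fun i _ => abs_sub_comm _ _
    have hcoeff : ∑ i : Fin n, (2 * (i : ℝ) + 1 - (n + 1)) * b i.castSucc
        = ∑ i : Fin n, (2 * (i : ℝ) + 1 - n) * b i.castSucc - ∑ i : Fin n, b i.castSucc := by
      rw [← Finset.sum_sub_distrib]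
      exact Finset.sum_congr rfl fun i _ => by ring
    simp only [Fin.sum_univ_castSucc, Finset.sum_add_distrib, Fin.val_castSucc, Fin.val_last,
      sub_self, abs_zero, add_zero, Nat.cast_add, Nat.cast_one, hcomm, hcoeff]
    simp only [Finset.sum_sub_distrib, Finset.sum_const, Finset.card_univ, Fintype.card_fin,
      nsmul_eq_mul] at hlast
    linarith

lemma abs_sub_add_abs_add (a b : ℝ) : |a - b| + |a + b| = 2 * max |a| |b| := by
  rcases abs_cases a with ⟨ha, _⟩ | ⟨ha, _⟩ <;> rcases abs_cases b with ⟨hb, _⟩ | ⟨hb, _⟩ <;>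
  rcases abs_cases (a - b) with ⟨hab, _⟩ | ⟨hab, _⟩ <;>
  rcases abs_cases (a + b) with ⟨hab', _⟩ | ⟨hab', _⟩ <;>
  rcases max_cases |a| |b| with ⟨hm, _⟩ | ⟨hm, _⟩ <;>
  linarith

/-- The family `-cₙ₋₁, …, -c₀, c₀, …, cₙ₋₁`. -/
def mirror {α : Type*} [Neg α] {n : ℕ} (c : Fin n → α) : Fin (n + n) → α :=
  Fin.append (fun i => -c i.rev) c

lemma sum_mirror {α β : Type*} [Neg α] [AddCommMonoid β] {n : ℕ} (c : Fin n → α) (f : α → β) :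
    ∑ i, f (mirror c i) = ∑ i, (f (-c i) + f (c i)) := by
  rw [Fin.sum_univ_add, Finset.sum_add_distrib]
  simp only [mirror, Fin.append_left, Fin.append_right]
  congr 1
  exact Equiv.sum_comp Fin.revPerm fun i => f (-c i)

lemma sum_abs_sub_mirror {n : ℕ} (c : Fin n → ℝ) :
    1 / 2 * ∑ i, ∑ j, |mirror c i - mirror c j| = maxSum c := by
  rw [sum_mirror c fun a => ∑ j, |a - mirror c j|]
  simp only [fun a => sum_mirror c fun b => |a - b|]
  rw [maxSum, Finset.mul_sum, Finset.mul_sum]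
  refine Finset.sum_congr rfl fun i _ => ?_
  rw [← Finset.sum_add_distrib, Finset.mul_sum, Finset.mul_sum]
  refine Finset.sum_congr rfl fun j _ => ?_
  have h := abs_sub_add_abs_add (c i) (c j)
  rw [sub_neg_eq_add, sub_neg_eq_add, neg_add_eq_sub, abs_sub_comm (c j),
    show -c i - c j = -(c i + c j) by ring, abs_neg]
  linarith

lemma sum_coeff_perm_mirror_le {n : ℕ} (c : Fin n → ℝ) (σ : Equiv.Perm (Fin (n + n))) (d : ℝ) :
    ∑ i : Fin (n + n), (2 * (i : ℝ) + d) * mirror c (σ i) ≤ maxSum c := by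
  have h0 : ∑ i, mirror c (σ i) = 0 := by
    rw [Equiv.sum_comp σ (mirror c), sum_mirror c fun a => a]
    simp
  have hsplit : ∑ i : Fin (n + n), (2 * (i : ℝ) + d) * mirror c (σ i)
      = ∑ i : Fin (n + n), (2 * ((i : ℕ) : ℝ) + 1 - (n + n : ℕ)) * mirror c (σ i)
        + (d - 1 + (n + n : ℕ)) * ∑ i, mirror c (σ i) := by
    rw [Finset.mul_sum, ← Finset.sum_add_distrib]
    exact Finset.sum_congr rfl fun i _ => by ring
  rw [hsplit, h0, mul_zero, add_zero, ← sum_abs_sub_mirror]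
  refine (sum_coeff_le_sum_abs_sub _ fun i => mirror c (σ i)).trans_eq ?_
  rw [Equiv.sum_comp σ fun a => ∑ j, |mirror c a - mirror c (σ j)|]
  simp only [fun a => Equiv.sum_comp σ fun b => |mirror c a - mirror c b|]

end Rearrangement

section Symmetry

lemma maxSum_eq_of_perm {n : ℕ} {c c' : Fin n → ℝ} (π : Equiv.Perm (Fin n))
    (h : ∀ i, |c' i| = |c (π i)|) : maxSum c' = maxSum c := by
  simp only [maxSum, h]
  rw [Equiv.sum_comp π fun a => ∑ j, max |c a| |c (π j)|]
  simp only [fun a => Equiv.sum_comp π fun b => max |c a| |c b|]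

lemma cubeSupport_neg_left (x y z : ℝ) : cubeSupport (-x) y z = cubeSupport x y z := by
  refine maxSum_eq_of_perm (Function.Involutive.toPerm ![6, 7, 11, 10, 9, 8, 0, 1, 5, 4, 3, 2]
    (by unfold Function.Involutive; decide)) fun i => abs_eq_abs.2 ?_
  fin_cases i <;> simp [formVal, cubeForm] <;> grind

lemma cubeSupport_neg_mid (x y z : ℝ) : cubeSupport x (-y) z = cubeSupport x y z := by
  refine maxSum_eq_of_perm (Function.Involutive.toPerm ![7, 6, 10, 11, 8, 9, 1, 0, 4, 5, 2, 3]
    (by unfold Function.Involutive; decide)) fun i => abs_eq_abs.2 ?_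
  fin_cases i <;> simp [formVal, cubeForm] <;> first | (left; ring1) | (right; ring1)

lemma cubeSupport_neg_right (x y z : ℝ) : cubeSupport x y (-z) = cubeSupport x y z := by
  refine maxSum_eq_of_perm (Function.Involutive.toPerm ![1, 0, 3, 2, 5, 4, 7, 6, 9, 8, 11, 10]
    (by unfold Function.Involutive; decide)) fun i => abs_eq_abs.2 ?_
  fin_cases i <;> simp [formVal, cubeForm] <;> (left; ring1)

lemma cubeSupport_swap_left (x y z : ℝ) : cubeSupport y x z = cubeSupport x y z := by
  refine maxSum_eq_of_perm (Function.Involutive.toPerm ![4, 5, 3, 2, 0, 1, 8, 9, 6, 7, 10, 11]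
    (by unfold Function.Involutive; decide)) fun i => abs_eq_abs.2 ?_
  fin_cases i <;> simp [formVal, cubeForm] <;> first | (left; ring1) | (right; ring1)

lemma cubeSupport_swap_right (x y z : ℝ) : cubeSupport x z y = cubeSupport x y z := by
  refine maxSum_eq_of_perm (Function.Involutive.toPerm ![6, 1, 4, 8, 2, 10, 0, 7, 3, 11, 5, 9]
    (by unfold Function.Involutive; decide)) fun i => abs_eq_abs.2 ?_
  fin_cases i <;> simp [formVal, cubeForm] <;> first | (left; ring1) | (right; ring1)

lemma cubeSupport_abs (x y z : ℝ) : cubeSupport |x| |y| |z| = cubeSupport x y z := by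
  rcases abs_choice x with hx | hx <;> rcases abs_choice y with hy | hy <;>
  rcases abs_choice z with hz | hz <;>
  simp only [hx, hy, hz, cubeSupport_neg_left, cubeSupport_neg_mid, cubeSupport_neg_right]

/-- It suffices to bound the support function on the chamber `x ≥ y ≥ z ≥ 0`. -/
lemma cubeSupport_sq_le_of_chamber {G : ℝ}
    (h : ∀ x y z : ℝ, 0 ≤ z → z ≤ y → y ≤ x →
      cubeSupport x y z ^ 2 ≤ G * (x ^ 2 + y ^ 2 + z ^ 2)) (x y z : ℝ) :
    cubeSupport x y z ^ 2 ≤ G * (x ^ 2 + y ^ 2 + z ^ 2) := by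
  rw [← cubeSupport_abs, ← sq_abs x, ← sq_abs y, ← sq_abs z]
  have hx := abs_nonneg x
  have hy := abs_nonneg y
  have hz := abs_nonneg z
  generalize |x| = a at *
  generalize |y| = b at *
  generalize |z| = c at *
  rcases le_total a b with hab | hab <;> rcases le_total b c with hbc | hbc <;>
    rcases le_total a c with hac | hac
  · have := h c b a hx hab hbc
    rw [cubeSupport_swap_left, cubeSupport_swap_right, cubeSupport_swap_left] at this
    linarith
  · have := h c b a hx hab hbc
    rw [cubeSupport_swap_left, cubeSupport_swap_right, cubeSupport_swap_left] at this
    linarith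
  · have := h b c a hx hac hbc
    rw [cubeSupport_swap_right, cubeSupport_swap_left] at this
    linarith
  · have := h b a c hz hac hab
    rw [cubeSupport_swap_left] at this
    linarith
  · have := h c a b hy hab hac
    rw [cubeSupport_swap_left, cubeSupport_swap_right] at this
    linarith
  · have := h a c b hy hbc hac
    rw [cubeSupport_swap_right] at this
    linarith
  · exact h a b c hz hbc hab
  · exact h a b c hz hbc hab

end Symmetry

section Certificate

/-- An integral direction together with an upper bound of `10 ^ 8` times the support function. -/
structure BoundedPoint where
  x : ℤ
  y : ℤ
  z : ℤ
  bound : ℕ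

/-- An upper bound of `10 ^ 8 * |ξ * t + r|`. -/
def formBound (p : ℤ × ℤ) : ℕ :=
  max (41421356 * p.1 + 100000000 * p.2).natAbs (41421357 * p.1 + 100000000 * p.2).natAbs

def supportBound (x y z : ℤ) : ℕ :=
  2 * ∑ i, ∑ j, max (formBound (cubeForm x y z i)) (formBound (cubeForm x y z j))

namespace BoundedPoint

def ofCoords (x y z : ℤ) : BoundedPoint := ⟨x, y, z, supportBound x y z⟩

def double (A : BoundedPoint) : BoundedPoint := ⟨2 * A.x, 2 * A.y, 2 * A.z, 2 * A.bound⟩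

def add (A B : BoundedPoint) : BoundedPoint := ofCoords (A.x + B.x) (A.y + B.y) (A.z + B.z)

/-- The certificate for a pair of points in the region where the bound is not attained. -/
def EdgeOK (A B : BoundedPoint) : Prop :=
  (A.bound * B.bound : ℤ) ≤ 798044 * 10 ^ 15 * (A.x * B.x + A.y * B.y + A.z * B.z)

instance (A B : BoundedPoint) : Decidable (A.EdgeOK B) := by unfold EdgeOK; infer_instance

/-- A certificate for `0 ≤ ξ * t + r`. -/
def FormNonneg (p : ℤ × ℤ) : Prop :=
  0 ≤ 41421356 * p.1 + 100000000 * p.2 ∧ 0 ≤ 41421357 * p.1 + 100000000 * p.2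

instance (p : ℤ × ℤ) : Decidable (FormNonneg p) := by unfold FormNonneg; infer_instance

/-- A certificate that the forms are nonnegative and increasing at a point. -/
def Ordered (A : BoundedPoint) : Prop :=
  FormNonneg (cubeForm A.x A.y A.z 0) ∧
    ∀ i : Fin 11, FormNonneg (cubeForm A.x A.y A.z i.succ - cubeForm A.x A.y A.z i.castSucc)

instance (A : BoundedPoint) : Decidable A.Ordered := by unfold Ordered; infer_instance

/-- The bound is valid. -/
def Valid (A : BoundedPoint) : Prop := 10 ^ 8 * cubeSupport A.x A.y A.z ≤ A.bound

end BoundedPoint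

open BoundedPoint

/-- Adaptive bisection of the cone generated by three directions. -/
def coneCheck : ℕ → BoundedPoint → BoundedPoint → BoundedPoint → Bool
  | 0, _, _, _ => false
  | n + 1, A, B, C =>
    decide (A.EdgeOK A ∧ B.EdgeOK B ∧ C.EdgeOK C ∧ A.EdgeOK B ∧ A.EdgeOK C ∧ B.EdgeOK C) ||
    (decide (A.Ordered ∧ B.Ordered ∧ C.Ordered) ||
      (coneCheck n C.double A.double (A.add B) && coneCheck n B.double C.double (A.add B)))

lemma coneCheck_chamber :
    coneCheck 13 (ofCoords 1 0 0) (ofCoords 1 1 1) (ofCoords 1 1 0) = true := by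
  decide +kernel

lemma lt_sqrt_two : (1.41421356 : ℝ) < √2 := Real.lt_sqrt_of_sq_lt (by norm_num)

lemma sqrt_two_lt : √2 < (1.41421357 : ℝ) := (Real.sqrt_lt' (by norm_num)).2 (by norm_num)

lemma abs_form_le_formBound (p : ℤ × ℤ) :
    10 ^ 8 * |(√2 - 1) * (p.1 : ℝ) + p.2| ≤ formBound p := by
  have h1 := lt_sqrt_two
  have h2 := sqrt_two_lt
  rw [formBound, Nat.cast_max, Nat.cast_natAbs, Nat.cast_natAbs]
  push_cast
  rw [le_max_iff]
  by_contra! hcon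
  obtain ⟨ha, hb⟩ := hcon
  have hmul : (10 : ℝ) ^ 8 * |(√2 - 1) * (p.1 : ℝ) + p.2|
      = |10 ^ 8 * ((√2 - 1) * (p.1 : ℝ) + p.2)| := by
    rw [abs_mul, abs_of_pos (by positivity : (0 : ℝ) < 10 ^ 8)]
  rw [hmul] at ha hb
  rcases abs_cases (10 ^ 8 * ((√2 - 1) * (p.1 : ℝ) + p.2)) with ⟨h, _⟩ | ⟨h, _⟩ <;>
    rw [h, abs_lt] at ha hb <;>
    rcases le_total 0 (p.1 : ℝ) with hp | hp <;> nlinarith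

lemma form_nonneg_of_formNonneg {p : ℤ × ℤ} (h : FormNonneg p) :
    0 ≤ (√2 - 1) * (p.1 : ℝ) + p.2 := by
  have h1 := lt_sqrt_two
  have h2 := sqrt_two_lt
  obtain ⟨ha, hb⟩ := h
  have ha' : (0 : ℝ) ≤ 41421356 * p.1 + 100000000 * p.2 := by exact_mod_cast ha
  have hb' : (0 : ℝ) ≤ 41421357 * p.1 + 100000000 * p.2 := by exact_mod_cast hb
  rcases le_total 0 (p.1 : ℝ) with hp | hp <;> nlinarith

lemma cubeForm_cast (x y z : ℤ) (i : Fin 12) :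
    cubeForm (x : ℝ) y z i = (((cubeForm x y z i).1 : ℝ), ((cubeForm x y z i).2 : ℝ)) := by
  fin_cases i <;> simp [cubeForm]

lemma valid_ofCoords (x y z : ℤ) : (ofCoords x y z).Valid := by
  have h (i : Fin 12) : 10 ^ 8 * |formVal x y z i| ≤ formBound (cubeForm x y z i) := by
    rw [formVal, cubeForm_cast]
    exact abs_form_le_formBound _
  simp only [Valid, ofCoords, supportBound, cubeSupport, maxSum]
  push_cast
  rw [mul_left_comm, Finset.mul_sum]
  refine mul_le_mul_of_nonneg_left (Finset.sum_le_sum fun i _ => ?_) zero_le_two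
  rw [Finset.mul_sum]
  refine Finset.sum_le_sum fun j _ => ?_
  rw [mul_max_of_nonneg _ _ (by positivity)]
  exact max_le_max (h i) (h j)

lemma formVal_combination (α β γ x₁ y₁ z₁ x₂ y₂ z₂ x₃ y₃ z₃ : ℝ) (i : Fin 12) :
    formVal (α * x₁ + β * x₂ + γ * x₃) (α * y₁ + β * y₂ + γ * y₃) (α * z₁ + β * z₂ + γ * z₃) i
      = α * formVal x₁ y₁ z₁ i + β * formVal x₂ y₂ z₂ i + γ * formVal x₃ y₃ z₃ i := by
  fin_cases i <;> simp [formVal, cubeForm] <;> ring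

lemma cubeSupport_combination_le {α β γ : ℝ} (hα : 0 ≤ α) (hβ : 0 ≤ β) (hγ : 0 ≤ γ)
    (x₁ y₁ z₁ x₂ y₂ z₂ x₃ y₃ z₃ : ℝ) :
    cubeSupport (α * x₁ + β * x₂ + γ * x₃) (α * y₁ + β * y₂ + γ * y₃)
        (α * z₁ + β * z₂ + γ * z₃)
      ≤ α * cubeSupport x₁ y₁ z₁ + β * cubeSupport x₂ y₂ z₂ + γ * cubeSupport x₃ y₃ z₃ := by
  have habs (a b c : ℝ) : |α * a + β * b + γ * c| ≤ α * |a| + β * |b| + γ * |c| := by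
    refine (abs_add_three _ _ _).trans_eq ?_
    rw [abs_mul, abs_mul, abs_mul, abs_of_nonneg hα, abs_of_nonneg hβ, abs_of_nonneg hγ]
  simp only [cubeSupport, maxSum, formVal_combination]
  rw [mul_left_comm α, mul_left_comm β, mul_left_comm γ, ← mul_add, ← mul_add]
  refine mul_le_mul_of_nonneg_left ?_ zero_le_two
  simp only [Finset.mul_sum, ← Finset.sum_add_distrib]
  refine Finset.sum_le_sum fun i _ => Finset.sum_le_sum fun j _ => max_le ?_ ?_
  · refine (habs _ _ _).trans ?_
    gcongr <;> exact le_max_left _ _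
  · refine (habs _ _ _).trans ?_
    gcongr <;> exact le_max_right _ _

lemma maxSum_of_monotone {c : Fin 12 → ℝ} (h0 : 0 ≤ c 0) (hc : Monotone c) :
    maxSum c = 2 * ∑ i : Fin 12, (2 * (i : ℝ) + 1) * c i := by
  have hnn (i : Fin 12) : 0 ≤ c i := h0.trans (hc (Fin.zero_le i))
  simp only [maxSum, abs_of_nonneg (hnn _), ← hc.map_max]
  congr 1
  have hmax : ∀ a b : Fin 12, max a b = if a ≤ b then b else a := fun a b => max_def a b
  simp only [Fin.sum_univ_succ, hmax]
  simp
  ring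

/-- The bound in the region where the forms are nonnegative and increasing. -/
lemma cubeSupport_sq_le_of_monotone {x y z : ℝ} (h0 : 0 ≤ formVal x y z 0)
    (hc : Monotone (formVal x y z)) :
    cubeSupport x y z ^ 2 ≤ (47040 + 23168 * √2) * (x ^ 2 + y ^ 2 + z ^ 2) := by
  have hval : cubeSupport x y z
      = (176 + 48 * √2) * x + (96 + 32 * √2) * y + (8 + 8 * √2) * z := by
    rw [cubeSupport, maxSum_of_monotone h0 hc]
    simp [Fin.sum_univ_succ, formVal, cubeForm]
    ring
  have hnorm : (47040 + 23168 * √2 : ℝ)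
      = (176 + 48 * √2) ^ 2 + (96 + 32 * √2) ^ 2 + (8 + 8 * √2) ^ 2 := by
    linear_combination (-3392) * Real.sq_sqrt (zero_le_two (α := ℝ))
  rw [hval, hnorm]
  linarith [sq_nonneg ((176 + 48 * √2) * y - (96 + 32 * √2) * x),
    sq_nonneg ((176 + 48 * √2) * z - (8 + 8 * √2) * x),
    sq_nonneg ((96 + 32 * √2) * z - (8 + 8 * √2) * y)]

lemma cubeSupport_nonneg (x y z : ℝ) : 0 ≤ cubeSupport x y z := by
  unfold cubeSupport maxSum
  positivity

lemma cubeSupport_sq_le_of_edgeOK {A B C : BoundedPoint} (hA : A.Valid) (hB : B.Valid)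
    (hC : C.Valid) (hAA : A.EdgeOK A) (hBB : B.EdgeOK B) (hCC : C.EdgeOK C) (hAB : A.EdgeOK B)
    (hAC : A.EdgeOK C) (hBC : B.EdgeOK C) {α β γ : ℝ} (hα : 0 ≤ α) (hβ : 0 ≤ β) (hγ : 0 ≤ γ)
    {x y z : ℝ} (hx : x = α * A.x + β * B.x + γ * C.x) (hy : y = α * A.y + β * B.y + γ * C.y)
    (hz : z = α * A.z + β * B.z + γ * C.z) :
    cubeSupport x y z ^ 2 ≤ (47040 + 23168 * √2) * (x ^ 2 + y ^ 2 + z ^ 2) := by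
  have hedge {P Q : BoundedPoint} (h : P.EdgeOK Q) : (P.bound * Q.bound : ℝ)
      ≤ 798044 * 10 ^ 15 * (P.x * Q.x + P.y * Q.y + P.z * Q.z) := by
    unfold EdgeOK at h
    exact_mod_cast h
  have hle : 10 ^ 8 * cubeSupport x y z ≤ α * A.bound + β * B.bound + γ * C.bound := by
    rw [hx, hy, hz]
    refine (mul_le_mul_of_nonneg_left (cubeSupport_combination_le hα hβ hγ ..)
      (by positivity)).trans ?_
    unfold Valid at hA hB hC
    nlinarith [mul_le_mul_of_nonneg_left hA hα, mul_le_mul_of_nonneg_left hB hβ,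
      mul_le_mul_of_nonneg_left hC hγ]
  have hsq := pow_le_pow_left₀ (mul_nonneg (by positivity) (cubeSupport_nonneg x y z)) hle 2
  have hquad : (α * A.bound + β * B.bound + γ * C.bound) ^ 2
      ≤ 798044 * 10 ^ 15 * (x ^ 2 + y ^ 2 + z ^ 2) := by
    rw [hx, hy, hz]
    linarith [mul_le_mul_of_nonneg_left (hedge hAA) (mul_nonneg hα hα),
      mul_le_mul_of_nonneg_left (hedge hBB) (mul_nonneg hβ hβ),
      mul_le_mul_of_nonneg_left (hedge hCC) (mul_nonneg hγ hγ),
      mul_le_mul_of_nonneg_left (hedge hAB) (mul_nonneg hα hβ),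
      mul_le_mul_of_nonneg_left (hedge hAC) (mul_nonneg hα hγ),
      mul_le_mul_of_nonneg_left (hedge hBC) (mul_nonneg hβ hγ)]
  have hG : (798044 / 10 : ℝ) ≤ 47040 + 23168 * √2 := by linarith [lt_sqrt_two]
  refine le_trans ?_ (mul_le_mul_of_nonneg_right hG (by positivity))
  rw [mul_pow] at hsq
  linarith

lemma cubeSupport_sq_le_of_ordered {A B C : BoundedPoint} (hA : A.Ordered) (hB : B.Ordered)
    (hC : C.Ordered) {α β γ : ℝ} (hα : 0 ≤ α) (hβ : 0 ≤ β) (hγ : 0 ≤ γ)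
    {x y z : ℝ} (hx : x = α * A.x + β * B.x + γ * C.x) (hy : y = α * A.y + β * B.y + γ * C.y)
    (hz : z = α * A.z + β * B.z + γ * C.z) :
    cubeSupport x y z ^ 2 ≤ (47040 + 23168 * √2) * (x ^ 2 + y ^ 2 + z ^ 2) := by
  have hzero {P : BoundedPoint} (h : P.Ordered) : 0 ≤ formVal P.x P.y P.z 0 := by
    rw [formVal, cubeForm_cast]
    exact form_nonneg_of_formNonneg h.1
  have hstep {P : BoundedPoint} (h : P.Ordered) (i : Fin 11) :
      formVal P.x P.y P.z i.castSucc ≤ formVal P.x P.y P.z i.succ := by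
    have := form_nonneg_of_formNonneg (h.2 i)
    rw [Prod.fst_sub, Prod.snd_sub] at this
    push_cast at this
    simp only [formVal, cubeForm_cast]
    linarith
  subst hx hy hz
  refine cubeSupport_sq_le_of_monotone ?_ (Fin.monotone_iff_le_succ.2 fun i => ?_)
  · rw [formVal_combination]
    have := hzero hA
    have := hzero hB
    have := hzero hC
    positivity
  · rw [formVal_combination, formVal_combination]
    have := hstep hA i
    have := hstep hB i
    have := hstep hC i
    gcongr

lemma valid_double {A : BoundedPoint} (hA : A.Valid) : A.double.Valid := by
  have h := cubeSupport_combination_le (zero_le_two (α := ℝ)) le_rfl le_rfl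
    A.x A.y A.z 0 0 0 0 0 0
  simp only [Valid, double] at hA ⊢
  push_cast
  norm_num at h
  linarith

lemma cubeSupport_sq_le_of_coneCheck {n : ℕ} {A B C : BoundedPoint}
    (h : coneCheck n A B C = true) (hA : A.Valid) (hB : B.Valid) (hC : C.Valid)
    {α β γ : ℝ} (hα : 0 ≤ α) (hβ : 0 ≤ β) (hγ : 0 ≤ γ)
    {x y z : ℝ} (hx : x = α * A.x + β * B.x + γ * C.x) (hy : y = α * A.y + β * B.y + γ * C.y)
    (hz : z = α * A.z + β * B.z + γ * C.z) :
    cubeSupport x y z ^ 2 ≤ (47040 + 23168 * √2) * (x ^ 2 + y ^ 2 + z ^ 2) := by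
  induction n generalizing A B C α β γ with
  | zero => simp [coneCheck] at h
  | succ n ih =>
    simp only [coneCheck, Bool.or_eq_true, Bool.and_eq_true, decide_eq_true_eq] at h
    rcases h with ⟨hAA, hBB, hCC, hAB, hAC, hBC⟩ | ⟨oA, oB, oC⟩ | ⟨h₁, h₂⟩
    · exact cubeSupport_sq_le_of_edgeOK hA hB hC hAA hBB hCC hAB hAC hBC hα hβ hγ hx hy hz
    · exact cubeSupport_sq_le_of_ordered oA oB oC hα hβ hγ hx hy hz
    · rcases le_total β α with hαβ | hαβ
      · refine ih h₁ (valid_double hC) (valid_double hA) (valid_ofCoords _ _ _)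
          (div_nonneg hγ zero_le_two) (div_nonneg (sub_nonneg.2 hαβ) zero_le_two) hβ ?_ ?_ ?_ <;>
        simp only [hx, hy, hz, double, add, ofCoords] <;> push_cast <;> ring
      · refine ih h₂ (valid_double hB) (valid_double hC) (valid_ofCoords _ _ _)
          (div_nonneg (sub_nonneg.2 hαβ) zero_le_two) (div_nonneg hγ zero_le_two) hα ?_ ?_ ?_ <;>
        simp only [hx, hy, hz, double, add, ofCoords] <;> push_cast <;> ring

lemma cubeSupport_sq_le (x y z : ℝ) :
    cubeSupport x y z ^ 2 ≤ (47040 + 23168 * √2) * (x ^ 2 + y ^ 2 + z ^ 2) := by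
  refine cubeSupport_sq_le_of_chamber (fun x y z hz hzy hyx => ?_) x y z
  refine cubeSupport_sq_le_of_coneCheck coneCheck_chamber (valid_ofCoords _ _ _)
    (valid_ofCoords _ _ _) (valid_ofCoords _ _ _) (sub_nonneg.2 hyx) hz (sub_nonneg.2 hzy)
    ?_ ?_ ?_ <;> simp [ofCoords]

end Certificate

section Vertices

/-- The vertex whose `i`-th inner product with `(x, y, z)` is `formVal x y z i`. -/
def formVec (i : Fin 12) : E3 :=
  WithLp.toLp 2 ![formVal 1 0 0 i, formVal 0 1 0 i, formVal 0 0 1 i]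

lemma inner_formVec (i : Fin 12) (u : E3) :
    inner ℝ (formVec i) u = formVal (u 0) (u 1) (u 2) i := by
  have h := formVal_combination (u 0) (u 1) (u 2) 1 0 0 0 1 0 0 0 1 i
  simp only [mul_one, mul_zero, add_zero, zero_add] at h
  simp [PiLp.inner_apply, Fin.sum_univ_three, formVec, h]

/-- The vertex with signs `s` whose `k`-th coordinate is `± ξ`. -/
def cubeVertex (p : Fin 3 × (Fin 3 → ℤˣ)) : E3 :=
  WithLp.toLp 2 fun j => ((p.2 j : ℤ) : ℝ) * if j = p.1 then √2 - 1 else 1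

lemma sign_cast (s : ℤˣ) : ((s : ℤ) : ℝ) = 1 ∨ ((s : ℤ) : ℝ) = -1 := by
  rcases Int.units_eq_one_or s with rfl | rfl <;> simp

lemma cubeVertex_injective : Function.Injective cubeVertex := by
  rintro ⟨k, s⟩ ⟨l, t⟩ h
  have h1 := lt_sqrt_two
  have h2 := sqrt_two_lt
  have hcoord (j : Fin 3) : ((s j : ℤ) : ℝ) * (if j = k then √2 - 1 else 1)
      = ((t j : ℤ) : ℝ) * if j = l then √2 - 1 else 1 := congrArg (fun v : E3 => v j) h
  have hkl : k = l := by
    by_contra hne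
    have hk := hcoord k
    rw [if_pos rfl, if_neg hne] at hk
    rcases sign_cast (s k) with hs | hs <;> rcases sign_cast (t k) with ht | ht <;>
      rw [hs, ht] at hk <;> linarith
  subst hkl
  refine Prod.ext rfl (funext fun j => Units.ext ?_)
  have hj : (if j = k then √2 - 1 else 1) ≠ 0 := by split_ifs <;> linarith
  exact_mod_cast mul_right_cancel₀ hj (hcoord j)

lemma range_cubeVertex : Set.range cubeVertex = truncatedCube := by
  have hentry (i : Fin 3) : ![√2 - 1, 1, 1] i = if i = 0 then √2 - 1 else 1 := by
    fin_cases i <;> simp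
  ext v
  constructor
  · rintro ⟨⟨k, s⟩, rfl⟩
    refine ⟨Equiv.swap k 0, fun j => ((s j : ℤ) : ℝ), fun j => sign_cast _, ?_⟩
    ext j
    simp [cubeVertex, hentry, Equiv.swap_apply_eq_iff]
  · rintro ⟨σ, s, hs, rfl⟩
    refine ⟨(σ.symm 0, fun j => if s j = 1 then 1 else -1), ?_⟩
    ext j
    rcases hs j with h | h <;> norm_num [cubeVertex, hentry, h, Equiv.eq_symm_apply]

def formLabel : Fin 12 → Fin 3 × (Fin 3 → ℤˣ) :=
  ![(0, ![-1, 1, -1]), (0, ![-1, 1, 1]), (2, ![1, -1, -1]), (2, ![1, -1, 1]),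
    (1, ![1, -1, -1]), (1, ![1, -1, 1]), (0, ![1, 1, -1]), (0, ![1, 1, 1]),
    (1, ![1, 1, -1]), (1, ![1, 1, 1]), (2, ![1, 1, -1]), (2, ![1, 1, 1])]

def vertexLabel : Fin (12 + 12) → Fin 3 × (Fin 3 → ℤˣ) :=
  Fin.append (fun i => ((formLabel i.rev).1, -(formLabel i.rev).2)) formLabel

lemma formVec_eq (i : Fin 12) : formVec i = cubeVertex (formLabel i) := by
  ext j
  fin_cases i <;> fin_cases j <;> simp [formVec, cubeVertex, formLabel, formVal, cubeForm]

lemma mirror_formVec : mirror formVec = cubeVertex ∘ vertexLabel := by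
  funext i
  refine Fin.addCases (fun i => ?_) (fun i => ?_) i
  · simp only [mirror, vertexLabel, Function.comp_apply, Fin.append_left, formVec_eq]
    ext j
    simp [cubeVertex, neg_ite]
  · simp only [mirror, vertexLabel, Function.comp_apply, Fin.append_right, formVec_eq]

lemma vertexLabel_bijective : Function.Bijective vertexLabel := by
  refine (Fintype.bijective_iff_injective_and_card _).2 ⟨?_, by simp⟩
  unfold Function.Injective
  decide +kernel

lemma mirror_formVec_injective : Function.Injective (mirror formVec) := by
  rw [mirror_formVec]
  exact cubeVertex_injective.comp vertexLabel_bijective.1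

lemma range_mirror_formVec : Set.range (mirror formVec) = truncatedCube := by
  rw [mirror_formVec, vertexLabel_bijective.2.range_comp, range_cubeVertex]

end Vertices

lemma inner_mirror_formVec (i : Fin (12 + 12)) (u : E3) :
    inner ℝ (mirror formVec i) u = mirror (formVal (u 0) (u 1) (u 2)) i := by
  refine Fin.addCases (fun i => ?_) (fun i => ?_) i
  · simp only [mirror, Fin.append_left, inner_neg_left, inner_formVec]
  · simp only [mirror, Fin.append_right, inner_formVec]

lemma norm_tupleAvg_sq_le {v : Fin 24 → E3} (hv : Function.Injective v)
    (hr : Set.range v = truncatedCube) : ‖tupleAvg 24 v‖ ^ 2 ≤ 47040 + 23168 * √2 := by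
  have hmem (i : Fin 24) : ∃ j : Fin 24, mirror formVec j = v i := by
    have : v i ∈ Set.range (mirror formVec) := by
      rw [range_mirror_formVec, ← hr]
      exact Set.mem_range_self i
    exact this
  choose σ hσ using hmem
  have hσi : Function.Injective σ := fun i j h => hv (by rw [← hσ i, ← hσ j, h])
  let π : Equiv.Perm (Fin (12 + 12)) := Equiv.ofBijective σ (Finite.injective_iff_bijective.1 hσi)
  set u := tupleAvg 24 v with hu
  have hle : ‖u‖ ^ 2 ≤ cubeSupport (u 0) (u 1) (u 2) := by
    rw [← real_inner_self_eq_norm_sq]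
    nth_rewrite 1 [hu]
    rw [tupleAvg, sum_inner]
    refine le_trans (le_of_eq ?_)
      (sum_coeff_perm_mirror_le (formVal (u 0) (u 1) (u 2)) π (3 - 24))
    refine Finset.sum_congr rfl fun i _ => ?_
    rw [real_inner_smul_left, ← hσ i, inner_mirror_formVec]
    simp only [π, Equiv.ofBijective_apply]
    push_cast
    ring
  have hsq := cubeSupport_sq_le (u 0) (u 1) (u 2)
  have hnorm : ‖u‖ ^ 2 = u 0 ^ 2 + u 1 ^ 2 + u 2 ^ 2 := by
    simp [EuclideanSpace.norm_sq_eq, Fin.sum_univ_three]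
  rw [← hnorm] at hsq
  have hpow := (pow_le_pow_left₀ (by positivity) hle 2).trans hsq
  rcases (sq_nonneg ‖u‖).eq_or_lt with h0 | h0
  · rw [← h0]
    positivity
  · rw [sq (‖u‖ ^ 2)] at hpow
    exact le_of_mul_le_mul_right hpow h0

lemma norm_tupleAvg_mirror_formVec_sq :
    ‖tupleAvg 24 (mirror formVec : Fin 24 → E3)‖ ^ 2 = 47040 + 23168 * √2 := by
  have hinner (u : E3) : inner ℝ (tupleAvg 24 (mirror formVec : Fin 24 → E3)) u
      = (176 + 48 * √2) * u 0 + (96 + 32 * √2) * u 1 + (8 + 8 * √2) * u 2 := by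
    rw [tupleAvg, sum_inner]
    have h : ∑ i : Fin (12 + 12), (2 * (i : ℝ) + 3 - (24 : ℕ)) * inner ℝ (mirror formVec i) u
        = (176 + 48 * √2) * u 0 + (96 + 32 * √2) * u 1 + (8 + 8 * √2) * u 2 := by
      simp only [inner_mirror_formVec]
      rw [Fin.sum_univ_add]
      simp only [mirror, Fin.append_left, Fin.append_right]
      simp [Fin.sum_univ_succ, formVal, cubeForm, Fin.rev]
      ring
    simpa only [real_inner_smul_left] using h
  have hcoord (j : Fin 3) : tupleAvg 24 (mirror formVec : Fin 24 → E3) j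
      = ![176 + 48 * √2, 96 + 32 * √2, 8 + 8 * √2] j := by
    have h := hinner (EuclideanSpace.single j 1)
    rw [EuclideanSpace.inner_single_right] at h
    fin_cases j <;> simpa using h
  rw [EuclideanSpace.norm_sq_eq, Fin.sum_univ_three]
  simp only [hcoord, Real.norm_eq_abs, sq_abs]
  simp only [Matrix.cons_val]
  linear_combination 3392 * Real.sq_sqrt (zero_le_two (α := ℝ))

lemma isGreatest_normSqSet_truncatedCube :
    IsGreatest (normSqSet truncatedCube 24) (47040 + 23168 * √2) := by
  refine ⟨⟨mirror formVec, mirror_formVec_injective, range_mirror_formVec,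
    norm_tupleAvg_mirror_formVec_sq.symm⟩, ?_⟩
  rintro _ ⟨v, hv, hr, rfl⟩
  exact norm_tupleAvg_sq_le hv hr

lemma normSqSet_smul {c : ℝ} (hc : c ≠ 0) (𝒱 : Set E3) (N : ℕ) :
    normSqSet (c • 𝒱) N = (fun x => c ^ 2 * x) '' normSqSet 𝒱 N := by
  have hnorm (a : ℝ) (v : Fin N → E3) :
      ‖tupleAvg N fun i => a • v i‖ ^ 2 = a ^ 2 * ‖tupleAvg N v‖ ^ 2 := by
    have h : (tupleAvg N fun i => a • v i) = a • tupleAvg N v := by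
      simp only [tupleAvg, Finset.smul_sum, smul_comm a]
    rw [h, norm_smul, mul_pow, Real.norm_eq_abs, sq_abs]
  have hrange (a : ℝ) (v : Fin N → E3) : (Set.range fun i => a • v i) = a • Set.range v :=
    Set.range_comp (a • ·) v
  ext x
  constructor
  · rintro ⟨v, hv, hr, rfl⟩
    refine ⟨_, ⟨fun i => c⁻¹ • v i, (smul_right_injective E3 (inv_ne_zero hc)).comp hv, ?_, rfl⟩, ?_⟩
    · rw [hrange, hr, inv_smul_smul₀ hc]
    · simp only [hnorm]
      field_simp
  · rintro ⟨_, ⟨v, hv, hr, rfl⟩, rfl⟩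
    exact ⟨fun i => c • v i, (smul_right_injective E3 hc).comp hv, by rw [hrange, hr],
      (hnorm c v).symm⟩

lemma abs_guesswork_sub_lt :
    |(1 / 2 : ℝ) * (24 + 1 - √((47040 + 23168 * √2) / (5 - 2 * √2)) / 24) - 8.5062| < 0.0001 := by
  have h1 := lt_sqrt_two
  have h2 := sqrt_two_lt
  have hd : (0 : ℝ) < 5 - 2 * √2 := by linarith
  have hlo : 191.698 < √((47040 + 23168 * √2) / (5 - 2 * √2)) := by
    refine Real.lt_sqrt_of_sq_lt ?_
    rw [lt_div_iff₀ hd]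
    linarith
  have hhi : √((47040 + 23168 * √2) / (5 - 2 * √2)) < 191.706 := by
    rw [Real.sqrt_lt' (by norm_num), div_lt_iff₀ hd]
    linarith
  rw [abs_lt]
  constructor <;> linarith

theorem truncatedCube_guesswork :
    IsGreatest (normSqSet truncatedCube 24) (47040 + 23168 * Real.sqrt 2) ∧
    IsGreatest
      (normSqSet ((Real.sqrt (5 - 2 * Real.sqrt 2))⁻¹ • truncatedCube) 24)
      ((47040 + 23168 * Real.sqrt 2) / (5 - 2 * Real.sqrt 2)) ∧
    |(1 / 2 : ℝ) * (24 + 1 -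
        Real.sqrt ((47040 + 23168 * Real.sqrt 2) / (5 - 2 * Real.sqrt 2)) / 24) -
      8.5062| < 0.0001 := by
  refine ⟨isGreatest_normSqSet_truncatedCube, ?_, abs_guesswork_sub_lt⟩
  have hd : (0 : ℝ) < 5 - 2 * √2 := by linarith [sqrt_two_lt]
  have hsq : (√(5 - 2 * √2))⁻¹ ^ 2 = (5 - 2 * √2)⁻¹ := by rw [inv_pow, Real.sq_sqrt hd.le]
  rw [normSqSet_smul (inv_ne_zero (Real.sqrt_ne_zero'.2 hd)), hsq, div_eq_inv_mul]
  exact (monotone_mul_left_of_nonneg (inv_nonneg.2 hd.le)).map_isGreatest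
    isGreatest_normSqSet_truncatedCube
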